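/- arXiv:1009.3676 — 2 statements merged into one kernel-verified Lean document; each statement's English description precedes it below -/
import Mathlib

section
/- Let d ≥ 1, n > d, and m ≥ 1. Then C(C(n,d), m) = Σ_{T ∈ L(n,d)} κ_{n,d}(m, T), where C(a,b) denotes the binomial coefficient; equivalently, every m-element set of d-element subsets of {1,…,n} determines a unique T ∈ L(n,d) that is the least upper bound of the corresponding m hyperplanes, and the κ_{n,d}(m,·) counts partition the C(C(n,d), m) such sets. -/
attribute [local instance] Classical.propDecidable

/-- Collections of subsets of `{1,…,n}` (modelled as `Fin n`). -/
abbrev Coll (n : ℕ) := Finset (Finset (Fin n))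

/-- `codim_d X = d + 1 - |X|`. -/
def codim {n : ℕ} (d : ℕ) (X : Finset (Fin n)) : ℤ := (d : ℤ) + 1 - X.card

/-- `ρ_d T = Σ_{X ∈ T} codim_d X`. -/
def rho {n : ℕ} (d : ℕ) (T : Coll n) : ℤ := ∑ X ∈ T, codim d X

/-- `D_d T = codim_d (T_1 ∩ … ∩ T_l) - ρ_d T` (used when `|T| ≥ 2`). -/
def Dd {n : ℕ} (d : ℕ) (T : Coll n) : ℤ := codim d (T.inf id) - rho d T

/-- Membership in the lattice `L(n,d)`. -/
def memL (n d : ℕ) (T : Coll n) : Prop :=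
  (∀ T' ⊆ T, 2 ≤ T'.card → 0 < Dd d T') ∧ ∀ X ∈ T, X.card ≤ d

/-- The intersection lattice `L(n,d)`. -/
structure L (n d : ℕ) where
  val : Coll n
  mem : memL n d val

namespace L

instance (n d : ℕ) : PartialOrder (L n d) where
  le S T := S = T ∨ (rho d S.val < rho d T.val ∧ ∀ X ∈ S.val, ∃ Y ∈ T.val, Y ⊆ X)
  le_refl S := Or.inl rfl
  le_trans S T U hST hTU := by
    rcases hST with rfl | hST
    · exact hTU
    · rcases hTU with rfl | hTU
      · exact Or.inr hST
      · refine Or.inr ⟨hST.1.trans hTU.1, fun X hX => ?_⟩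
        obtain ⟨Y, hY, hYX⟩ := hST.2 X hX
        obtain ⟨Z, hZ, hZY⟩ := hTU.2 Y hY
        exact ⟨Z, hZ, hZY.trans hYX⟩
  le_antisymm S T hST hTS := by
    rcases hST with rfl | hST
    · rfl
    · rcases hTS with rfl | hTS
      · rfl
      · exact absurd (hST.1.trans hTS.1) (lt_irrefl _)

noncomputable instance (n d : ℕ) : Fintype (L n d) :=
  Fintype.ofInjective (fun T : L n d => T.val)
    (fun a b h => by cases a; cases b; simpa using h)

end L

/-- The minimum element `∅` of `L(n,d)`. -/
def Lbot (n d : ℕ) : L n d :=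
  ⟨∅, by
    constructor
    · intro T' hT' h2
      rw [Finset.subset_empty] at hT'
      subst hT'
      simp at h2
    · intro X hX
      simp at hX⟩

/-- The maximum element `{∅}` of `L(n,d)`. -/
def Ltop (n d : ℕ) : L n d :=
  ⟨{∅}, by
    constructor
    · intro T' hT' h2
      have h1 : T'.card ≤ 1 := (Finset.card_le_card hT').trans_eq (Finset.card_singleton _)
      exact absurd h2 (by omega)
    · intro X hX
      rw [Finset.mem_singleton] at hX
      subst hX
      simp⟩

/-- The singleton collection `{X}` as an element of `L(n,d)`. -/
def singL (n d : ℕ) (X : Finset (Fin n)) (hX : X.card ≤ d) : L n d :=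
  ⟨{X}, by
    constructor
    · intro T' hT' h2
      have h1 : T'.card ≤ 1 := (Finset.card_le_card hT').trans_eq (Finset.card_singleton _)
      exact absurd h2 (by omega)
    · intro Y hY
      rw [Finset.mem_singleton] at hY
      subst hY
      exact hX⟩

/-- The type of `T ∈ L(n,d)`: the multiset of codimensions of its members. -/
def typeOf {n : ℕ} (d : ℕ) (T : L n d) : Multiset ℕ :=
  T.val.val.map (fun X => d + 1 - X.card)

/-- `λ_{n,d}(γ)`: the number of elements of `L(n,d)` of type `γ`. -/
noncomputable def lam (n d : ℕ) (γ : Multiset ℕ) : ℕ :=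
  (Finset.univ.filter (fun T : L n d => typeOf d T = γ)).card

/-- `κ_{n,d}(m,T)`: the number of `m`-element sets of `d`-element subsets of `{1,…,n}`
whose corresponding hyperplanes have least upper bound `T` in `L(n,d)`. -/
noncomputable def kappa (n d m : ℕ) (T : L n d) : ℕ :=
  (Finset.univ.filter (fun H : Coll n =>
      H.card = m ∧ (∀ X ∈ H, X.card = d) ∧
      IsLUB {S : L n d | ∃ X ∈ H, S.val = {X}} T)).card

/-- Every member of `S` contains a member of `T`. -/
def Refines {n : ℕ} (S T : Coll n) : Prop := ∀ X ∈ S, ∃ Y ∈ T, Y ⊆ X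

section codim

variable {n d : ℕ}

lemma codim_pos {X : Finset (Fin n)} (hX : X.card ≤ d) : 0 < codim d X := by
  unfold codim
  omega

lemma codim_anti {X Y : Finset (Fin n)} (h : X ⊆ Y) : codim d Y ≤ codim d X := by
  have := Finset.card_le_card h
  unfold codim
  omega

lemma eq_of_subset_of_codim_le {X Y : Finset (Fin n)} (h : X ⊆ Y)
    (hle : codim d X ≤ codim d Y) : X = Y := by
  refine Finset.eq_of_subset_of_card_le h ?_
  unfold codim at hle
  omega

lemma codim_eq_codim_union_add (A Y : Finset (Fin n)) :
    codim d Y = codim d (A ∪ Y) + (A \ Y).card := by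
  have h := Finset.card_sdiff_add_card A Y
  unfold codim
  omega

end codim

section rho

variable {n d : ℕ}

lemma rho_union_le {S T : Coll n} (hS : ∀ X ∈ S, X.card ≤ d) :
    rho d (S ∪ T) ≤ rho d S + rho d T := by
  have h : rho d (S ∪ T) + rho d (S ∩ T) = rho d S + rho d T := Finset.sum_union_inter
  have h0 : 0 ≤ rho d (S ∩ T) :=
    Finset.sum_nonneg fun X hX => (codim_pos (hS X (Finset.mem_inter.1 hX).1)).le
  omega

lemma rho_sdiff_add {S T : Coll n} (h : S ⊆ T) : rho d (T \ S) + rho d S = rho d T :=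
  Finset.sum_sdiff h

/-- The inequality `D_d > 0`, together with its trivial analogue for singletons. -/
lemma rho_le_codim_inf {T F : Coll n} (hT : memL n d T) (hF : F ⊆ T) (hne : F.Nonempty) :
    rho d F ≤ codim d (F.inf id) := by
  rcases Nat.lt_or_ge 1 F.card with h | h
  · have := hT.1 F hF h
    unfold Dd at this
    omega
  · obtain ⟨X, rfl⟩ := Finset.card_eq_one.1 (le_antisymm h hne.card_pos)
    simp [rho]

end rho

section order

variable {n d : ℕ}

/-- On `L(n,d)`, refinement together with the reverse inequality of ranks forces equality. -/
lemma eq_of_refines_of_rho_le {S T : Coll n} (hS : memL n d S) (hT : memL n d T)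
    (h : Refines S T) (hle : rho d T ≤ rho d S) : S = T := by
  choose! φ hφT hφ using h
  have hfib : ∀ Y ∈ T, rho d (S.filter (φ · = Y)) ≤ codim d Y := by
    intro Y hY
    rcases (S.filter (φ · = Y)).eq_empty_or_nonempty with h0 | h0
    · simpa [h0, rho] using (codim_pos (hT.2 Y hY)).le
    · refine (rho_le_codim_inf hS (Finset.filter_subset _ _) h0).trans (codim_anti ?_)
      refine Finset.le_inf fun X hX => ?_
      obtain ⟨hXS, rfl⟩ := Finset.mem_filter.1 hX
      exact hφ X hXS
  have hsum : ∑ Y ∈ T, rho d (S.filter (φ · = Y)) = rho d S :=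
    Finset.sum_fiberwise_of_maps_to hφT _
  have heq : ∀ Y ∈ T, rho d (S.filter (φ · = Y)) = codim d Y :=
    (Finset.sum_eq_sum_iff_of_le hfib).1 (le_antisymm (Finset.sum_le_sum hfib) (hsum ▸ hle))
  have hfix : ∀ Y ∈ T, S.filter (φ · = Y) = {Y} := by
    intro Y hY
    have hpos := codim_pos (hT.2 Y hY)
    have hYF : ∀ X ∈ S.filter (φ · = Y), Y ⊆ X := by
      intro X hX
      obtain ⟨hXS, rfl⟩ := Finset.mem_filter.1 hX
      exact hφ X hXS
    have hF := heq Y hY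
    have hsub := Finset.filter_subset (φ · = Y) S
    generalize S.filter (φ · = Y) = F at hF hYF hsub
    rcases Nat.lt_or_ge 1 F.card with h | h
    · have h1 := hS.1 F hsub h
      have h2 : codim d (F.inf id) ≤ codim d Y := codim_anti (Finset.le_inf hYF)
      unfold Dd at h1
      omega
    · rcases F.eq_empty_or_nonempty with rfl | hne
      · simp [rho] at hF
        omega
      · obtain ⟨X, rfl⟩ := Finset.card_eq_one.1 (le_antisymm h hne.card_pos)
        rw [eq_of_subset_of_codim_le (d := d) (hYF X (by simp)) (by simp [rho] at hF; omega)]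
  ext X
  constructor
  · intro hX
    have : X ∈ S.filter (φ · = φ X) := by simp [hX]
    rw [hfix _ (hφT X hX), Finset.mem_singleton] at this
    rw [this]
    exact hφT X hX
  · intro hX
    have : X ∈ S.filter (φ · = X) := by simp [hfix X hX]
    exact (Finset.mem_filter.1 this).1

lemma L.le_iff_refines {S T : L n d} : S ≤ T ↔ Refines S.val T.val := by
  constructor
  · rintro (rfl | h)
    · exact fun X hX => ⟨X, hX, subset_rfl⟩
    · exact h.2
  · intro h
    rcases lt_or_ge (rho d S.val) (rho d T.val) with hlt | hge
    · exact Or.inr ⟨hlt, h⟩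
    · refine Or.inl ?_
      have := eq_of_refines_of_rho_le S.mem T.mem h hge
      cases S
      cases T
      simpa using this

end order

section join

variable {n d : ℕ}

/-- `T` consists of sets of size at most `d` and every member of `H` contains one of them. -/
def Covers (d : ℕ) (H T : Coll n) : Prop := Refines H T ∧ ∀ X ∈ T, X.card ≤ d

/-- Among the covers of `H`, there is one of least rank, and of least size among those. -/
lemma exists_minimal_cover {H : Coll n} (hH : ∀ X ∈ H, X.card ≤ d) :
    ∃ T, Covers d H T ∧ (∀ T', Covers d H T' → rho d T ≤ rho d T') ∧
      ∀ T', Covers d H T' → rho d T' ≤ rho d T → T.card ≤ T'.card := by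
  obtain ⟨T, hT, hmin⟩ := Finset.exists_min_image
    (Finset.univ.filter fun T : Coll n => Covers d H T)
    (fun T => toLex (rho d T, T.card))
    ⟨H, Finset.mem_filter.2 ⟨Finset.mem_univ _, fun X hX => ⟨X, hX, subset_rfl⟩, hH⟩⟩
  simp only [Finset.mem_filter, Finset.mem_univ, true_and, Prod.Lex.toLex_le_toLex] at hT hmin
  refine ⟨T, hT, fun T' h' => ?_, fun T' h' hle => ?_⟩
  · rcases hmin T' h' with h | h
    · exact h.le
    · exact h.1.le
  · rcases hmin T' h' with h | h
    · omega
    · exact h.2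

/-- A minimal cover lies in `L(n,d)`: a subcollection violating `D_d > 0` could be replaced by
its intersection. -/
lemma memL_of_minimal_cover {H T : Coll n} (hT : Covers d H T)
    (hcard : ∀ T', Covers d H T' → rho d T' ≤ rho d T → T.card ≤ T'.card) : memL n d T := by
  refine ⟨fun F hF h2 => ?_, hT.2⟩
  by_contra! hD
  obtain ⟨X₀, hX₀⟩ : F.Nonempty := Finset.card_pos.1 (by omega)
  have hinf : ∀ X ∈ ({F.inf id} : Coll n), X.card ≤ d := by
    intro X hX
    rw [Finset.mem_singleton] at hX
    subst hX
    exact (Finset.card_le_card (Finset.inf_le (f := id) hX₀)).trans (hT.2 X₀ (hF hX₀))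
  have hsd : ∀ X ∈ T \ F, X.card ≤ d := fun X hX => hT.2 X (Finset.mem_sdiff.1 hX).1
  have hcov : Covers d H (T \ F ∪ {F.inf id}) := by
    refine ⟨fun X hX => ?_, fun X hX => (Finset.mem_union.1 hX).elim (hsd X) (hinf X)⟩
    obtain ⟨Y, hY, hYX⟩ := hT.1 X hX
    by_cases hYF : Y ∈ F
    · exact ⟨F.inf id, by simp, (Finset.inf_le (f := id) hYF).trans hYX⟩
    · exact ⟨Y, by simp [hY, hYF], hYX⟩
  have hrho : rho d (T \ F ∪ {F.inf id}) ≤ rho d T := by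
    have h1 := rho_union_le (T := {F.inf id}) hsd
    have h3 := rho_sdiff_add (d := d) hF
    have h4 : rho d {F.inf id} = codim d (F.inf id) := by simp [rho]
    unfold Dd at hD
    omega
  have h5 := hcard _ hcov hrho
  have h6 := Finset.card_union_le (T \ F) {F.inf id}
  have h7 := Finset.card_sdiff_add_card_eq_card hF
  rw [Finset.card_singleton] at h6
  omega

/-- If the members of `F` jointly satisfy `D_d > 0`, then `codim_d A` exceeds the total
codimension of the sets `A ∪ Y`, `Y ∈ F`. -/
lemma sum_codim_union_lt {F : Coll n} (A : Finset (Fin n)) (hF : 0 < Dd d F) :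
    ∑ Y ∈ F, codim d (A ∪ Y) < codim d A := by
  have h1 : rho d F = ∑ Y ∈ F, codim d (A ∪ Y) + ∑ Y ∈ F, ((A \ Y).card : ℤ) := by
    rw [← Finset.sum_add_distrib]
    exact Finset.sum_congr rfl fun Y _ => codim_eq_codim_union_add A Y
  have h2 : A \ F.inf id ⊆ F.biUnion (A \ ·) := by
    intro x hx
    simpa [Finset.mem_inf, Finset.mem_sdiff, and_left_comm] using hx
  have h3 : (A \ F.inf id).card ≤ ∑ Y ∈ F, (A \ Y).card :=
    (Finset.card_le_card h2).trans Finset.card_biUnion_le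
  have h4 : A.card ≤ (A \ F.inf id).card + (F.inf id).card := by
    have := Finset.le_card_sdiff (F.inf id) A
    omega
  zify at h3 h4
  unfold Dd at hF
  unfold codim at *
  omega

/-- A cover of least rank refines every cover that lies in `L(n,d)`. -/
lemma refines_of_minimal_cover {H T U : Coll n} (hH : ∀ X ∈ H, X.card ≤ d)
    (hT : Covers d H T) (hmin : ∀ T', Covers d H T' → rho d T ≤ rho d T')
    (hU : memL n d U) (hHU : Refines H U) : Refines T U := by
  intro A hA
  set F := U.filter fun Y => (A ∪ Y).card ≤ d with hFdef
  have hT₁ : ∀ X ∈ T \ {A}, X.card ≤ d := fun X hX => hT.2 X (Finset.mem_sdiff.1 hX).1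
  have hT₂ : ∀ X ∈ F.image (A ∪ ·), X.card ≤ d := by
    simp only [Finset.mem_image, hFdef, Finset.mem_filter]
    rintro _ ⟨Y, ⟨-, hY⟩, rfl⟩
    exact hY
  have hcov : Covers d H (T \ {A} ∪ F.image (A ∪ ·)) := by
    refine ⟨fun X hX => ?_, fun X hX => (Finset.mem_union.1 hX).elim (hT₁ X) (hT₂ X)⟩
    obtain ⟨B, hB, hBX⟩ := hT.1 X hX
    by_cases hBA : B = A
    · subst hBA
      obtain ⟨Y, hY, hYX⟩ := hHU X hX
      have hBY := Finset.union_subset hBX hYX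
      refine ⟨B ∪ Y, Finset.mem_union_right _ (Finset.mem_image_of_mem _ ?_), hBY⟩
      exact Finset.mem_filter.2 ⟨hY, (Finset.card_le_card hBY).trans (hH X hX)⟩
    · exact ⟨B, by simp [hB, hBA], hBX⟩
  have hle : codim d A ≤ ∑ Y ∈ F, codim d (A ∪ Y) := by
    have h1 := hmin _ hcov
    have h2 := rho_union_le (T := F.image (A ∪ ·)) hT₁
    have h3 := rho_sdiff_add (d := d) (Finset.singleton_subset_iff.2 hA)
    have h4 : rho d {A} = codim d A := by simp [rho]
    have h5 : rho d (F.image (A ∪ ·)) ≤ ∑ Y ∈ F, codim d (A ∪ Y) :=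
      Finset.sum_image_le_of_nonneg fun Y hY => (codim_pos (hT₂ Y hY)).le
    omega
  have hF1 : F.card ≤ 1 := by
    by_contra! h
    exact absurd (sum_codim_union_lt A (hU.1 F (Finset.filter_subset _ _) h)) hle.not_gt
  obtain ⟨Y, hFY⟩ : ∃ Y, F = {Y} := by
    refine Finset.card_eq_one.1 (le_antisymm hF1 (Finset.card_pos.2 ?_))
    rw [Finset.nonempty_iff_ne_empty]
    intro h0
    have := codim_pos (hT.2 A hA)
    rw [h0, Finset.sum_empty] at hle
    omega
  have hYF : Y ∈ F := by simp [hFY]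
  rw [hFY, Finset.sum_singleton] at hle
  refine ⟨Y, (Finset.mem_filter.1 hYF).1, ?_⟩
  rw [eq_of_subset_of_codim_le Finset.subset_union_left hle]
  exact Finset.subset_union_right

/-- Every set of hyperplanes has a least upper bound in `L(n,d)`. -/
lemma exists_isLUB_hyperplanes {H : Coll n} (hH : ∀ X ∈ H, X.card = d) :
    ∃ T : L n d, IsLUB {S : L n d | ∃ X ∈ H, S.val = {X}} T := by
  have hH' : ∀ X ∈ H, X.card ≤ d := fun X hX => (hH X hX).le
  have hub : ∀ T : L n d,
      T ∈ upperBounds {S : L n d | ∃ X ∈ H, S.val = {X}} ↔ Refines H T.val := by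
    intro T
    constructor
    · intro h X hX
      exact L.le_iff_refines.1 (h (a := singL n d X (hH' X hX)) ⟨X, hX, rfl⟩) X
        (Finset.mem_singleton_self X)
    · rintro h S ⟨X, hX, hS⟩
      rw [L.le_iff_refines, hS]
      intro Y hY
      rw [Finset.mem_singleton.1 hY]
      exact h X hX
  obtain ⟨T, hT, hrho, hcard⟩ := exists_minimal_cover hH'
  refine ⟨⟨T, memL_of_minimal_cover hT hcard⟩, (hub _).2 hT.1, fun U hU => ?_⟩
  exact L.le_iff_refines.2 (refines_of_minimal_cover hH' hT hrho U.mem ((hub U).1 hU))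

end join

/-- `C(C(n,d), m) = Σ_{T ∈ L(n,d)} κ_{n,d}(m, T)`: every
`m`-element set of `d`-element subsets of `{1,…,n}` determines a unique least
upper bound in `L(n,d)`, and the counts `κ_{n,d}(m,·)` partition the
`C(C(n,d),m)` such sets. -/
theorem sum_kappa (n d m : ℕ) (hd : 1 ≤ d) (hnd : d < n) (hm : 1 ≤ m) :
    Nat.choose (Nat.choose n d) m = ∑ T : L n d, kappa n d m T := by
  unfold kappa
  rw [← Finset.card_biUnion]
  · have h : (((Finset.univ : Finset (Fin n)).powersetCard d).powersetCard m).card =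
        Nat.choose (Nat.choose n d) m := by
      simp
    rw [← h]
    congr 1
    ext H
    simp only [Finset.mem_powersetCard, Finset.mem_biUnion, Finset.mem_univ, true_and,
      Finset.mem_filter]
    constructor
    · rintro ⟨hH, hc⟩
      have hH' : ∀ X ∈ H, X.card = d := fun X hX => (Finset.mem_powersetCard.1 (hH hX)).2
      obtain ⟨T, hT⟩ := exists_isLUB_hyperplanes hH'
      exact ⟨T, hc, hH', hT⟩
    · rintro ⟨T, hc, hH, -⟩
      exact ⟨fun X hX => Finset.mem_powersetCard.2 ⟨Finset.subset_univ X, hH X hX⟩, hc⟩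
  · intro S _ T _ hST
    refine Finset.disjoint_left.2 fun H hS hT => hST ?_
    exact (Finset.mem_filter.1 hS).2.2.2.unique (Finset.mem_filter.1 hT).2.2.2
end

section
/- Let n ≥ 4. Then μ_{n,3}(⊤) = −1 + n − C(n,2) + C(n,3) + 20·C(n,5) + 170·C(n,6) + 630·C(n,7) + 840·C(n,8) + 280·C(n,9), where ⊤ = {∅} is the maximum element of the poset L(n,3), μ_{n,3}(⊤) = μ_{n,3}(∅, ⊤) is the Möbius function value from the minimum element, and C(a,b) denotes the binomial coefficient (equal to 0 when b > a). -/
attribute [local instance] Classical.propDecidable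

open Finset

/-- Subsets of a disjoint union, counted by the sizes of their three parts. -/
lemma card_filter_inter_inter_inter {α : Type*} [Fintype α] [DecidableEq α] (P Q W : Finset α)
    (hPQ : Disjoint P Q) (hPW : Disjoint P W) (hQW : Disjoint Q W) (i j k : ℕ) :
    #{C : Finset α | C ⊆ P ∪ Q ∪ W ∧ #(C ∩ P) = i ∧ #(C ∩ Q) = j ∧ #(C ∩ W) = k} =
      (#P).choose i * (#Q).choose j * (#W).choose k := by
  have hR : (#P).choose i * (#Q).choose j * (#W).choose k =
      #(powersetCard i P ×ˢ powersetCard j Q ×ˢ powersetCard k W) := by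
    simp [card_product, mul_assoc]
  rw [hR]
  have key : ∀ X ⊆ P, ∀ Y ⊆ Q, ∀ Z ⊆ W, (X ∪ Y ∪ Z) ∩ P = X ∧ (X ∪ Y ∪ Z) ∩ Q = Y ∧
      (X ∪ Y ∪ Z) ∩ W = Z := by
    intro X hX Y hY Z hZ
    rw [Finset.disjoint_left] at hPQ hPW hQW
    refine ⟨?_, ?_, ?_⟩ <;> ext a <;> have := @hX a <;> have := @hY a <;> have := @hZ a <;>
      have := @hPQ a <;> have := @hPW a <;> have := @hQW a <;>
      simp only [mem_inter, mem_union] <;> tauto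
  refine card_nbij' (fun C => (C ∩ P, C ∩ Q, C ∩ W)) (fun p => p.1 ∪ p.2.1 ∪ p.2.2) ?_ ?_ ?_ ?_
  · intro C hC
    simp only [coe_filter, mem_univ, true_and, Set.mem_ofPred_eq] at hC
    simp [hC]
  · rintro ⟨X, Y, Z⟩ h
    simp only [coe_product, Set.mem_prod, mem_coe, mem_powersetCard] at h
    obtain ⟨⟨hX, hi⟩, ⟨hY, hj⟩, hZ, hk⟩ := h
    obtain ⟨h1, h2, h3⟩ := key X hX Y hY Z hZ
    simp only [coe_filter, mem_univ, true_and, Set.mem_ofPred_eq, h1, h2, h3]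
    exact ⟨union_subset_union (union_subset_union hX hY) hZ, hi, hj, hk⟩
  · intro C hC
    simp only [coe_filter, mem_univ, true_and, Set.mem_ofPred_eq] at hC
    simp only
    rw [← inter_union_distrib_left, ← inter_union_distrib_left]
    exact inter_eq_left.2 hC.1
  · rintro ⟨X, Y, Z⟩ h
    simp only [coe_product, Set.mem_prod, mem_coe, mem_powersetCard] at h
    obtain ⟨⟨hX, -⟩, ⟨hY, -⟩, hZ, -⟩ := h
    obtain ⟨h1, h2, h3⟩ := key X hX Y hY Z hZ
    simp only [h1, h2, h3]

lemma card_inter_add_card_inter_add_card_inter {α : Type*} [DecidableEq α] {C P Q W : Finset α}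
    (hPQ : Disjoint P Q) (hPW : Disjoint P W) (hQW : Disjoint Q W) (hC : C ⊆ P ∪ Q ∪ W) :
    #(C ∩ P) + #(C ∩ Q) + #(C ∩ W) = #C := by
  conv_rhs => rw [← inter_eq_left.2 hC, inter_union_distrib_left, inter_union_distrib_left]
  rw [card_union_of_disjoint, card_union_of_disjoint]
  · exact hPQ.mono inter_subset_right inter_subset_right
  · exact disjoint_union_left.2 ⟨hPW.mono inter_subset_right inter_subset_right,
      hQW.mono inter_subset_right inter_subset_right⟩

lemma card_filter_card_inter {α : Type*} [Fintype α] [DecidableEq α] (P : Finset α) (m i : ℕ) (hi : i ≤ m) :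
    #{C : Finset α | #C = m ∧ #(C ∩ P) = i} =
      (#P).choose i * (Fintype.card α - #P).choose (m - i) := by
  have h := card_filter_inter_inter_inter P ∅ Pᶜ (disjoint_empty_right _)
    disjoint_compl_right (disjoint_empty_left _) i 0 (m - i)
  simp only [card_compl, card_empty, Nat.choose_zero_right, mul_one] at h
  rw [← h]
  congr 1
  ext C
  have := card_inter_add_card_inter_add_card_inter (C := C) (disjoint_empty_right P)
    disjoint_compl_right (disjoint_empty_left Pᶜ) (by simp)
  simp only [mem_filter, mem_univ, true_and, union_empty, union_compl, subset_univ, inter_empty,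
    card_empty] at this ⊢
  omega

/-- Three-element subsets of a disjoint union meeting the first two parts at most once each. -/
lemma card_filter_card_three {α : Type*} [Fintype α] [DecidableEq α] (P Q W : Finset α)
    (hPQ : Disjoint P Q) (hPW : Disjoint P W) (hQW : Disjoint Q W) :
    #{C : Finset α | C ⊆ P ∪ Q ∪ W ∧ #C = 3 ∧ #(C ∩ P) ≤ 1 ∧ #(C ∩ Q) ≤ 1} =
      (#W).choose 3 + (#P + #Q) * (#W).choose 2 + #P * #Q * #W := by
  rw [card_eq_sum_card_fiberwise (f := fun C => (#(C ∩ P), #(C ∩ Q))) (t := range 2 ×ˢ range 2)]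
  · have h : ∀ i j k, i + j + k = 3 → i ≤ 1 → j ≤ 1 →
        #{C ∈ ({C : Finset α | C ⊆ P ∪ Q ∪ W ∧ #C = 3 ∧ #(C ∩ P) ≤ 1 ∧ #(C ∩ Q) ≤ 1} :
          Finset (Finset α)) | (#(C ∩ P), #(C ∩ Q)) = (i, j)} =
        (#P).choose i * (#Q).choose j * (#W).choose k := by
      intro i j k hs hi hj
      rw [← card_filter_inter_inter_inter P Q W hPQ hPW hQW]
      congr 1
      ext C
      simp only [mem_filter, mem_univ, true_and, Prod.mk.injEq]
      constructor
      · rintro ⟨⟨h, h3, -, -⟩, h1, h2⟩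
        have := card_inter_add_card_inter_add_card_inter hPQ hPW hQW h
        exact ⟨h, h1, h2, by omega⟩
      · rintro ⟨h, h1, h2, h3⟩
        have := card_inter_add_card_inter_add_card_inter hPQ hPW hQW h
        exact ⟨⟨h, by omega, by omega, by omega⟩, h1, h2⟩
    rw [sum_product]
    simp only [sum_range_succ, range_zero, sum_empty, zero_add]
    rw [h 0 0 3 rfl (by simp) (by simp), h 0 1 2 rfl (by simp) (by simp),
      h 1 0 2 rfl (by simp) (by simp), h 1 1 1 rfl (by simp) (by simp)]
    simp
    ring
  · intro C hC
    simp only [coe_filter, mem_univ, true_and, Set.mem_ofPred_eq] at hC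
    simp only [coe_product, Set.mem_prod, mem_coe, mem_range]
    omega

lemma card_ordered_pairs {α : Type*} [Fintype α] [DecidableEq α] (p : Finset α → Prop)
    {_ : DecidablePred fun T : Finset α => #T = 2 ∧ p T}
    [DecidablePred fun x : α × α => x.1 ≠ x.2 ∧ p {x.1, x.2}] :
    2 * #{T : Finset α | #T = 2 ∧ p T} = #{x : α × α | x.1 ≠ x.2 ∧ p {x.1, x.2}} := by
  rw [card_eq_sum_card_fiberwise (f := fun x : α × α => ({x.1, x.2} : Finset α))
    (t := {T : Finset α | #T = 2 ∧ p T}), sum_const_nat (m := 2), mul_comm]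
  · intro T hT
    simp only [mem_filter, mem_univ, true_and] at hT
    obtain ⟨hT, hp⟩ := hT
    obtain ⟨a, b, hab, rfl⟩ := card_eq_two.1 hT
    have : ({x ∈ ({x : α × α | x.1 ≠ x.2 ∧ p {x.1, x.2}} : Finset (α × α)) |
        ({x.1, x.2} : Finset α) = {a, b}} : Finset (α × α)) = {(a, b), (b, a)} := by
      ext ⟨x, y⟩
      simp only [mem_filter, mem_univ, true_and, mem_insert, mem_singleton, Prod.mk.injEq]
      constructor
      · rintro ⟨⟨hxy, -⟩, h⟩
        have hx : x ∈ ({a, b} : Finset α) := h ▸ by simp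
        have hy : y ∈ ({a, b} : Finset α) := h ▸ by simp
        simp only [mem_insert, mem_singleton] at hx hy
        grind
      · rintro (⟨rfl, rfl⟩ | ⟨rfl, rfl⟩)
        · exact ⟨⟨hab, hp⟩, rfl⟩
        · rw [pair_comm]
          exact ⟨⟨hab.symm, hp⟩, rfl⟩
    rw [this, card_pair]
    simp [hab]
  · rintro ⟨x, y⟩ h
    simp only [coe_filter, mem_univ, true_and, Set.mem_ofPred_eq] at h ⊢
    exact ⟨card_pair h.1, h.2⟩

lemma card_ordered_triples {α : Type*} [Fintype α] [DecidableEq α] (p : Finset α → Prop)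
    {_ : DecidablePred fun T : Finset α => #T = 3 ∧ p T}
    [DecidablePred fun x : α × α × α =>
      x.1 ≠ x.2.1 ∧ x.1 ≠ x.2.2 ∧ x.2.1 ≠ x.2.2 ∧ p {x.1, x.2.1, x.2.2}] :
    6 * #{T : Finset α | #T = 3 ∧ p T} =
      #{x : α × α × α | x.1 ≠ x.2.1 ∧ x.1 ≠ x.2.2 ∧ x.2.1 ≠ x.2.2 ∧ p {x.1, x.2.1, x.2.2}} := by
  rw [card_eq_sum_card_fiberwise (f := fun x : α × α × α => ({x.1, x.2.1, x.2.2} : Finset α))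
    (t := {T : Finset α | #T = 3 ∧ p T}), sum_const_nat (m := 6), mul_comm]
  · intro T hT
    simp only [mem_filter, mem_univ, true_and] at hT
    obtain ⟨hT, hp⟩ := hT
    obtain ⟨a, b, c, hab, hac, hbc, rfl⟩ := card_eq_three.1 hT
    have : ({x ∈ ({x : α × α × α | x.1 ≠ x.2.1 ∧ x.1 ≠ x.2.2 ∧ x.2.1 ≠ x.2.2 ∧
        p {x.1, x.2.1, x.2.2}} : Finset (α × α × α)) |
        ({x.1, x.2.1, x.2.2} : Finset α) = {a, b, c}} : Finset (α × α × α)) =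
        {(a, b, c), (a, c, b), (b, a, c), (b, c, a), (c, a, b), (c, b, a)} := by
      ext ⟨x, y, z⟩
      simp only [mem_filter, mem_univ, true_and, mem_insert, mem_singleton, Prod.mk.injEq]
      constructor
      · rintro ⟨⟨hxy, hxz, hyz, -⟩, h⟩
        have hx : x ∈ ({a, b, c} : Finset α) := h ▸ by simp
        have hy : y ∈ ({a, b, c} : Finset α) := h ▸ by simp
        have hz : z ∈ ({a, b, c} : Finset α) := h ▸ by simp
        simp only [mem_insert, mem_singleton] at hx hy hz
        grind
      · intro h
        have hs : ({x, y, z} : Finset α) = {a, b, c} := by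
          ext t
          simp only [mem_insert, mem_singleton]
          grind
        rw [hs]
        grind
    rw [this]
    repeat rw [card_insert_of_notMem (by simp; grind)]
    simp
  · rintro ⟨x, y, z⟩ h
    simp only [coe_filter, mem_univ, true_and, Set.mem_ofPred_eq] at h ⊢
    exact ⟨card_eq_three.2 ⟨x, y, z, h.1, h.2.1, h.2.2.1, rfl⟩, h.2.2.2⟩


section Membership

variable {n : ℕ}

lemma one_le_codim {X : Finset (Fin n)} (hX : #X ≤ 3) : 1 ≤ codim 3 X := by
  unfold codim
  omega

lemma codim_le_four (X : Finset (Fin n)) : codim 3 X ≤ 4 := by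
  unfold codim
  omega

lemma memL.subset {d : ℕ} {S T : Coll n} (hT : memL n d T) (h : S ⊆ T) : memL n d S :=
  ⟨fun T' hT' => hT.1 T' (hT'.trans h), fun X hX => hT.2 X (h hX)⟩

lemma memL.card_le_rho {T : Coll n} (hT : memL n 3 T) : (#T : ℤ) ≤ rho 3 T := by
  have : ∑ X ∈ T, (1 : ℤ) ≤ ∑ X ∈ T, codim 3 X :=
    sum_le_sum fun X hX => one_le_codim (hT.2 X hX)
  simpa [rho] using this

lemma memL.card_le {T : Coll n} (hT : memL n 3 T) : #T ≤ 3 := by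
  by_contra! h
  have h1 := hT.1 T Subset.rfl (by omega)
  have h2 := hT.card_le_rho
  have h3 := codim_le_four (T.inf id)
  unfold Dd at h1
  omega

lemma memL_singleton {d : ℕ} {X : Finset (Fin n)} : memL n d {X} ↔ #X ≤ d :=
  ⟨fun h => h.2 X (mem_singleton_self X), fun h => (singL n d X h).mem⟩

lemma Dd_pair {A B : Finset (Fin n)} (h : A ≠ B) :
    Dd 3 {A, B} = #A + #B - #(A ∩ B) - 4 := by
  simp only [Dd, rho, codim, inf_insert, inf_singleton, id, sum_pair h, inf_eq_inter]
  push_cast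
  ring

lemma Dd_triple {A B C : Finset (Fin n)} (hAB : A ≠ B) (hAC : A ≠ C) (hBC : B ≠ C) :
    Dd 3 {A, B, C} = #A + #B + #C - #(A ∩ (B ∩ C)) - 8 := by
  simp only [Dd, rho, codim, inf_insert, inf_singleton, id,
    sum_insert (show A ∉ ({B, C} : Coll n) by simp [hAB, hAC]), sum_pair hBC, inf_eq_inter]
  push_cast
  ring

lemma memL_pair {A B : Finset (Fin n)} (h : A ≠ B) :
    memL n 3 {A, B} ↔ #A ≤ 3 ∧ #B ≤ 3 ∧ #(A ∩ B) + 5 ≤ #A + #B := by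
  constructor
  · intro hT
    have h1 := hT.1 {A, B} Subset.rfl (card_pair h).ge
    rw [Dd_pair h] at h1
    exact ⟨hT.2 A (by simp), hT.2 B (by simp), by omega⟩
  · rintro ⟨hA, hB, hAB⟩
    refine ⟨fun T hT h2 => ?_, by simp [hA, hB]⟩
    rw [eq_of_subset_of_card_le hT ((card_pair h).trans_le h2), Dd_pair h]
    omega

lemma memL_triple {A B C : Finset (Fin n)} (hAB : A ≠ B) (hAC : A ≠ C) (hBC : B ≠ C) :
    memL n 3 {A, B, C} ↔ (#A = 3 ∧ #B = 3 ∧ #C = 3) ∧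
      #(A ∩ B) ≤ 1 ∧ #(A ∩ C) ≤ 1 ∧ #(B ∩ C) ≤ 1 ∧ #(A ∩ (B ∩ C)) = 0 := by
  have hcard : #({A, B, C} : Coll n) = 3 := card_eq_three.2 ⟨A, B, C, hAB, hAC, hBC, rfl⟩
  constructor
  · intro hT
    have h1 := hT.1 {A, B, C} Subset.rfl (by omega)
    have hA := hT.2 A (by simp)
    have hB := hT.2 B (by simp)
    have hC := hT.2 C (by simp)
    have h2 := ((memL_pair hAB).1 (hT.subset (by grind))).2.2
    have h3 := ((memL_pair hAC).1 (hT.subset (by grind))).2.2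
    have h4 := ((memL_pair hBC).1 (hT.subset (by grind))).2.2
    rw [Dd_triple hAB hAC hBC] at h1
    omega
  · rintro ⟨⟨hA, hB, hC⟩, h2, h3, h4, h5⟩
    refine ⟨fun T hT hT2 => ?_, by simp [hA, hB, hC]⟩
    have hpair : ∀ X Y : Finset (Fin n), T = {X, Y} → X ≠ Y → #X = 3 → #Y = 3 →
        #(X ∩ Y) ≤ 1 → 0 < Dd 3 T := by
      rintro X Y rfl hXY hX hY hi
      rw [Dd_pair hXY]
      omega
    have hT' : ∀ X, X ∈ T → X = A ∨ X = B ∨ X = C := fun X hX => by simpa using hT hX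
    by_cases hAT : A ∈ T
    · by_cases hBT : B ∈ T
      · by_cases hCT : C ∈ T
        · have : T = {A, B, C} := by grind
          rw [this, Dd_triple hAB hAC hBC]
          omega
        · exact hpair A B (by grind) hAB hA hB h2
      · by_cases hCT : C ∈ T
        · exact hpair A C (by grind) hAC hA hC h3
        · have : T = {A} := by grind
          simp [this] at hT2
    · have hs : T ⊆ {B, C} := by grind
      exact hpair B C (eq_of_subset_of_card_le hs ((card_pair hBC).trans_le hT2)) hBC hB hC h4

/-- The order relation of `L n 3` on the underlying collections. -/
def collLE (S T : Coll n) : Prop :=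
  S = T ∨ (rho 3 S < rho 3 T ∧ ∀ X ∈ S, ∃ Y ∈ T, Y ⊆ X)

lemma collLE_singleton_iff {T : Coll n} {X : Finset (Fin n)} (hT : memL n 3 T) (hX : #X ≤ 3) :
    collLE T {X} ↔ ∀ Z ∈ T, X ⊆ Z := by
  constructor
  · rintro (rfl | ⟨-, h⟩)
    · simp
    · simpa using h
  · intro h
    by_cases hTX : T = {X}
    · exact Or.inl hTX
    · refine Or.inr ⟨?_, by simpa using h⟩
      have hX1 := one_le_codim hX
      have hr : rho 3 {X} = codim 3 X := sum_singleton _ _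
      rw [hr]
      rcases lt_trichotomy (#T) 1 with h0 | h1 | h2
      · obtain rfl : T = ∅ := card_eq_zero.1 (by omega)
        simp only [rho, sum_empty]
        omega
      · obtain ⟨Z, rfl⟩ := card_eq_one.1 h1
        have hXZ : X ⊂ Z := (h Z (by simp)).ssubset_of_ne (by rintro rfl; exact hTX rfl)
        have := card_lt_card hXZ
        simp only [rho, sum_singleton, codim]
        omega
      · have h3 := hT.1 T Subset.rfl h2
        have h4 : #X ≤ #(T.inf id) := card_le_card (Finset.le_inf h)
        unfold Dd codim at h3
        unfold codim
        omega

lemma collLE_iff_subset {S T : Coll n} (hS : memL n 3 S) (hT : ∀ X ∈ T, #X = 3) :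
    collLE S T ↔ S ⊆ T := by
  constructor
  · rintro (rfl | ⟨-, h⟩) X hX
    · exact hX
    · obtain ⟨Y, hY, hYX⟩ := h X hX
      rwa [← eq_of_subset_of_card_le hYX ((hS.2 X hX).trans_eq (hT Y hY).symm)]
  · intro h
    by_cases hST : S = T
    · exact Or.inl hST
    · have hc : ∀ X ∈ T, codim 3 X = 1 := fun X hX => by simp [codim, hT X hX]
      refine Or.inr ⟨?_, fun X hX => ⟨X, h hX, Subset.rfl⟩⟩
      rw [rho, rho, sum_congr rfl hc, sum_congr rfl fun X hX => hc X (h hX)]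
      simpa using card_lt_card (h.ssubset_of_ne hST)

/-- Two-element members of `L(n,3)` consisting of triples. -/
noncomputable def triplePairs (n : ℕ) : Finset (Coll n) :=
  {T | #T = 2 ∧ memL n 3 T ∧ ∀ X ∈ T, #X = 3}

/-- Three-element members of `L(n,3)`. -/
noncomputable def tripleTriples (n : ℕ) : Finset (Coll n) :=
  {T | #T = 3 ∧ memL n 3 T}

/-- Disjoint pairs of a triple and a two-element set. -/
noncomputable def mixedPairs (n : ℕ) : Finset (Finset (Fin n) × Finset (Fin n)) :=
  {x | #x.1 = 3 ∧ #x.2 = 2 ∧ Disjoint x.1 x.2}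

lemma mem_tripleTriples_card {T : Coll n} (hT : T ∈ tripleTriples n) : ∀ X ∈ T, #X = 3 := by
  simp only [tripleTriples, mem_filter, mem_univ, true_and] at hT
  obtain ⟨hT, hm⟩ := hT
  obtain ⟨A, B, C, hAB, hAC, hBC, rfl⟩ := card_eq_three.1 hT
  obtain ⟨⟨hA, hB, hC⟩, -⟩ := (memL_triple hAB hAC hBC).1 hm
  simp [hA, hB, hC]

lemma memL_mixed {A Y : Finset (Fin n)} (hA : #A = 3) (hY : #Y = 2) (h : Disjoint A Y) :
    memL n 3 {A, Y} := by
  rw [memL_pair (by rintro rfl; omega), disjoint_iff_inter_eq_empty.1 h]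
  simp [hA, hY]

lemma sum_memL (g : Coll n → ℤ) :
    ∑ T with memL n 3 T, g T = g ∅ + ∑ X with #X ≤ 3, g {X} + ∑ T ∈ triplePairs n, g T +
      ∑ x ∈ mixedPairs n, g {x.1, x.2} + ∑ T ∈ tripleTriples n, g T := by
  have h1 : ∑ T with memL n 3 T, g T =
      ∑ k ∈ range 4, ∑ T ∈ ({T : Coll n | memL n 3 T} : Finset (Coll n)) with #T = k, g T := by
    refine (sum_fiberwise_of_maps_to (fun T hT => ?_) _).symm
    simpa using Nat.lt_succ_of_le (mem_filter.1 hT).2.card_le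
  have e0 : ∑ T ∈ ({T : Coll n | memL n 3 T} : Finset (Coll n)) with #T = 0, g T = g ∅ := by
    rw [← sum_singleton g ∅]
    congr 1
    ext T
    simp only [mem_filter, mem_univ, true_and, card_eq_zero, mem_singleton, and_iff_right_iff_imp]
    rintro rfl
    exact (Lbot n 3).mem
  have e1 : ∑ T ∈ ({T : Coll n | memL n 3 T} : Finset (Coll n)) with #T = 1, g T =
      ∑ X with #X ≤ 3, g {X} := by
    refine (sum_bij (fun X _ => {X}) ?_ ?_ ?_ ?_).symm
    · simp [memL_singleton]
    · simp
    · intro T hT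
      simp only [mem_filter, mem_univ, true_and] at hT
      obtain ⟨X, rfl⟩ := card_eq_one.1 hT.2
      exact ⟨X, by simpa using memL_singleton.1 hT.1, rfl⟩
    · simp
  have e3 : ∑ T ∈ ({T : Coll n | memL n 3 T} : Finset (Coll n)) with #T = 3, g T =
      ∑ T ∈ tripleTriples n, g T := by
    congr 1
    ext T
    simp [tripleTriples, and_comm]
  have e2 : ∑ T ∈ ({T : Coll n | memL n 3 T} : Finset (Coll n)) with #T = 2, g T =
      ∑ T ∈ triplePairs n, g T + ∑ x ∈ mixedPairs n, g {x.1, x.2} := by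
    rw [← sum_filter_add_sum_filter_not _ (fun T : Coll n => ∀ X ∈ T, #X = 3)]
    congr 1
    · congr 1
      ext T
      simp only [triplePairs, mem_filter, mem_univ, true_and]
      tauto
    · refine (sum_bij (fun x _ => {x.1, x.2}) ?_ ?_ ?_ ?_).symm
      · rintro ⟨A, Y⟩ h
        simp only [mixedPairs, mem_filter, mem_univ, true_and] at h ⊢
        obtain ⟨hA, hY, hd⟩ := h
        exact ⟨⟨memL_mixed hA hY hd, card_pair (by rintro rfl; omega)⟩, by simp [hY]⟩
      · rintro ⟨A, Y⟩ h ⟨A', Y'⟩ h' he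
        simp only [mixedPairs, mem_filter, mem_univ, true_and] at h h' he
        have h1 : A ∈ ({A', Y'} : Coll n) := he ▸ by simp
        have h2 : Y ∈ ({A', Y'} : Coll n) := he ▸ by simp
        simp only [mem_insert, mem_singleton] at h1 h2
        rcases h1 with rfl | rfl <;> rcases h2 with rfl | rfl <;> first | rfl | omega
      · intro T hT
        simp only [mem_filter, mem_univ, true_and] at hT
        obtain ⟨⟨hm, h2⟩, hn⟩ := hT
        obtain ⟨A, B, hAB, rfl⟩ := card_eq_two.1 h2
        obtain ⟨hA, hB, hi⟩ := (memL_pair hAB).1 hm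
        simp only [mem_insert, mem_singleton, forall_eq_or_imp, forall_eq] at hn
        simp only [mixedPairs, mem_filter, mem_univ, true_and, exists_prop, Prod.exists]
        by_cases h : #A = 3
        · refine ⟨A, B, ⟨h, by omega, ?_⟩, rfl⟩
          rw [disjoint_iff_inter_eq_empty, ← card_eq_zero]
          omega
        · refine ⟨B, A, ⟨by omega, by omega, ?_⟩, pair_comm _ _⟩
          rw [disjoint_iff_inter_eq_empty, inter_comm, ← card_eq_zero]
          omega
      · simp
  rw [h1]
  simp only [sum_range_succ, range_zero, sum_empty, zero_add]
  rw [e0, e1, e2, e3]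
  ring

end Membership

section Counting

variable {n : ℕ}

lemma card_filter_prod_of_const {α β : Type*} [Fintype α] [Fintype β] (p : α → Prop)
    (r : α → β → Prop) (c : ℕ) [DecidablePred p] [∀ a, DecidablePred (r a)]
    {_ : DecidablePred fun x : α × β => p x.1 ∧ r x.1 x.2} (h : ∀ a, p a → #{b | r a b} = c) :
    #{x : α × β | p x.1 ∧ r x.1 x.2} = #{a | p a} * c := by
  rw [card_filter, Fintype.sum_prod_type, card_eq_sum_ones, sum_mul, one_mul, sum_filter]
  refine sum_congr rfl fun a _ => ?_
  by_cases hp : p a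
  · rw [if_pos hp, ← h a hp, card_filter]
    simp [hp]
  · simp [hp]

lemma subset_iff_card_inter {α : Type*} [DecidableEq α] {X Z : Finset α} : X ⊆ Z ↔ #(Z ∩ X) = #X :=
  ⟨fun h => by rw [inter_eq_right.2 h],
    fun h => inter_eq_right.1 (eq_of_subset_of_card_le inter_subset_right h.ge)⟩

lemma card_filter_superset (X : Finset (Fin n)) (k : ℕ) (h : #X ≤ k) :
    #{Z : Finset (Fin n) | #Z = k ∧ X ⊆ Z} = (n - #X).choose (k - #X) := by
  simp only [subset_iff_card_inter]
  rw [card_filter_card_inter X k _ h]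
  simp

lemma card_filter_card_eq (k : ℕ) : #{Z : Finset (Fin n) | #Z = k} = n.choose k := by
  simp

lemma card_triplePairs_filter (X : Finset (Fin n)) :
    2 * #{T ∈ triplePairs n | ∀ Z ∈ T, X ⊆ Z} =
      #{x : Finset (Fin n) × Finset (Fin n) | (#x.1 = 3 ∧ X ⊆ x.1) ∧
        #x.2 = 3 ∧ X ⊆ x.2 ∧ #(x.2 ∩ x.1) ≤ 1} := by
  rw [triplePairs, filter_filter]
  simp only [and_assoc]
  rw [card_ordered_pairs]
  congr 1
  ext ⟨A, B⟩
  simp only [mem_filter, mem_univ, true_and, mem_insert, mem_singleton, forall_eq_or_imp,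
    forall_eq]
  constructor
  · rintro ⟨hAB, hm, ⟨hA, hB⟩, hXA, hXB⟩
    rw [memL_pair hAB] at hm
    rw [inter_comm]
    exact ⟨hA, hXA, hB, hXB, by omega⟩
  · rintro ⟨hA, hXA, hB, hXB, h⟩
    have hAB : A ≠ B := by
      rintro rfl
      rw [inter_self] at h
      omega
    rw [inter_comm] at h
    exact ⟨hAB, (memL_pair hAB).2 ⟨by omega, by omega, by omega⟩, ⟨hA, hB⟩, hXA, hXB⟩

lemma card_triplePairs_mem (x : Fin n) :
    2 * #{T ∈ triplePairs n | ∀ Z ∈ T, {x} ⊆ Z} = (n - 1).choose 2 * (n - 3).choose 2 := by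
  rw [card_triplePairs_filter, card_filter_prod_of_const (fun A => #A = 3 ∧ {x} ⊆ A)
    (fun A B => #B = 3 ∧ {x} ⊆ B ∧ #(B ∩ A) ≤ 1) ((n - 3).choose 2),
    card_filter_superset _ _ (by simp)]
  · simp
  · rintro A ⟨hA, hx⟩
    have hd : Disjoint {x} (A \ {x}) := disjoint_sdiff
    have h := card_filter_inter_inter_inter {x} (A \ {x}) Aᶜ hd
      (disjoint_compl_right.mono_left hx) (disjoint_compl_right.mono_left sdiff_subset) 1 0 2
    simp only [card_singleton, Nat.choose_self, Nat.choose_zero_right, one_mul, card_compl, hA,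
      Fintype.card_fin, union_sdiff_of_subset hx, union_compl, subset_univ, true_and] at h
    rw [← h]
    congr 1
    ext B
    have h1 := card_inter_add_card_inter_add_card_inter (C := B) hd
      (disjoint_compl_right.mono_left hx) (disjoint_compl_right.mono_left sdiff_subset)
      (by simp [union_sdiff_of_subset hx])
    have h2 : #(B ∩ {x}) + #(B ∩ (A \ {x})) = #(B ∩ A) := by
      rw [← card_union_of_disjoint (hd.mono inter_subset_right inter_subset_right),
        ← inter_union_distrib_left, union_sdiff_of_subset hx]
    simp only [mem_filter, mem_univ, true_and, subset_iff_card_inter, card_singleton]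
    omega

lemma card_triplePairs :
    2 * #(triplePairs n) = n.choose 3 * ((n - 3).choose 3 + 3 * (n - 3).choose 2) := by
  have h := card_triplePairs_filter (n := n) ∅
  simp only [empty_subset, implies_true, filter_true, and_true, true_and] at h
  rw [h, card_filter_prod_of_const (fun A => #A = 3) (fun A B => #B = 3 ∧ #(B ∩ A) ≤ 1)
    ((n - 3).choose 3 + 3 * (n - 3).choose 2), card_filter_card_eq]
  intro A hA
  have h := card_filter_card_three A ∅ Aᶜ (disjoint_empty_right _) disjoint_compl_right
    (disjoint_empty_left _)
  simpa [hA, card_compl] using h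

lemma card_mixedPairs : #(mixedPairs n) = n.choose 3 * (n - 3).choose 2 := by
  rw [mixedPairs, card_filter_prod_of_const (fun A => #A = 3) (fun A Y => #Y = 2 ∧ Disjoint A Y)
    ((n - 3).choose 2), card_filter_card_eq]
  intro A hA
  have h := card_filter_card_inter A 2 0 (by simp)
  simp only [Nat.choose_zero_right, Fintype.card_fin, hA, one_mul, card_eq_zero] at h
  simpa only [disjoint_iff_inter_eq_empty, inter_comm A] using h

/-- Triples meeting each of `A` and `B` at most once and avoiding `A ∩ B`. -/
lemma card_third_triple {A B : Finset (Fin n)} (hA : #A = 3) (hB : #B = 3) {i : ℕ}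
    (h : #(B ∩ A) = i) :
    #{C : Finset (Fin n) | #C = 3 ∧ #(C ∩ A) ≤ 1 ∧ #(C ∩ B) ≤ 1 ∧ Disjoint C (A ∩ B)} =
      (n - (6 - i)).choose 3 + 2 * (3 - i) * (n - (6 - i)).choose 2 +
        (3 - i) * (3 - i) * (n - (6 - i)) := by
  have e1 : #(A \ B) = 3 - i := by rw [card_sdiff, hA, h]
  have e2 : #(B \ A) = 3 - i := by rw [card_sdiff, hB, inter_comm, h]
  have hi : i ≤ 3 := by rw [← h, ← hB]; exact card_le_card inter_subset_left
  have e3 : #(A ∪ B)ᶜ = n - (6 - i) := by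
    have := card_union_add_card_inter A B
    rw [inter_comm, h, hA, hB] at this
    rw [card_compl, Fintype.card_fin]
    omega
  have h := card_filter_card_three (A \ B) (B \ A) (A ∪ B)ᶜ disjoint_sdiff_sdiff
    (disjoint_compl_right.mono_left (sdiff_subset.trans subset_union_left))
    (disjoint_compl_right.mono_left (sdiff_subset.trans subset_union_right))
  rw [e1, e2, e3, ← two_mul] at h
  rw [← h]
  congr 1
  ext C
  simp only [mem_filter, mem_univ, true_and]
  have hsub : C ⊆ A \ B ∪ B \ A ∪ (A ∪ B)ᶜ ↔ Disjoint C (A ∩ B) := by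
    rw [Finset.disjoint_left]
    refine forall₂_congr fun a _ => ?_
    simp only [mem_union, mem_sdiff, mem_compl, mem_inter]
    tauto
  rw [hsub]
  have hinter : Disjoint C (A ∩ B) → C ∩ (A \ B) = C ∩ A ∧ C ∩ (B \ A) = C ∩ B := by
    intro hd
    rw [Finset.disjoint_left] at hd
    constructor <;> ext a <;> have := @hd a <;> simp only [mem_inter, mem_sdiff] at this ⊢ <;>
      tauto
  constructor
  · rintro ⟨h3, h1, h2, hd⟩
    rw [(hinter hd).1, (hinter hd).2]
    exact ⟨hd, h3, h1, h2⟩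
  · rintro ⟨hd, h3, h1, h2⟩
    rw [(hinter hd).1] at h1
    rw [(hinter hd).2] at h2
    exact ⟨h3, h1, h2, hd⟩

lemma card_tripleTriples :
    6 * #(tripleTriples n) = n.choose 3 *
      ((n - 3).choose 3 * ((n - 6).choose 3 + 6 * (n - 6).choose 2 + 9 * (n - 6)) +
        3 * (n - 3).choose 2 * ((n - 5).choose 3 + 4 * (n - 5).choose 2 + 4 * (n - 5))) := by
  have h : 6 * #(tripleTriples n) = #{x : Finset (Fin n) × Finset (Fin n) × Finset (Fin n) |
      #x.1 = 3 ∧ (#x.2.1 = 3 ∧ #(x.2.1 ∩ x.1) ≤ 1) ∧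
        #x.2.2 = 3 ∧ #(x.2.2 ∩ x.1) ≤ 1 ∧ #(x.2.2 ∩ x.2.1) ≤ 1 ∧
          Disjoint x.2.2 (x.1 ∩ x.2.1)} := by
    rw [tripleTriples, card_ordered_triples]
    congr 1
    ext ⟨A, B, C⟩
    simp only [mem_filter, mem_univ, true_and]
    rw [disjoint_iff_inter_eq_empty, ← card_eq_zero, inter_comm C (A ∩ B), inter_assoc,
      inter_comm B A, inter_comm C A, inter_comm C B]
    constructor
    · rintro ⟨hAB, hAC, hBC, hm⟩
      obtain ⟨⟨hA, hB, hC⟩, h⟩ := (memL_triple hAB hAC hBC).1 hm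
      tauto
    · rintro ⟨hA, ⟨hB, h1⟩, hC, h2, h3, h4⟩
      have hne : ∀ {X Y : Finset (Fin n)}, #X = 3 → #(X ∩ Y) ≤ 1 → X ≠ Y := by
        rintro X Y hX h rfl
        rw [inter_self] at h
        omega
      exact ⟨hne hA h1, hne hA h2, hne hB h3,
        (memL_triple (hne hA h1) (hne hA h2) (hne hB h3)).2 ⟨⟨hA, hB, hC⟩, h1, h2, h3, h4⟩⟩
  rw [h, card_filter_prod_of_const (fun A => #A = 3)
    (fun A (y : Finset (Fin n) × Finset (Fin n)) => (#y.1 = 3 ∧ #(y.1 ∩ A) ≤ 1) ∧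
      #y.2 = 3 ∧ #(y.2 ∩ A) ≤ 1 ∧ #(y.2 ∩ y.1) ≤ 1 ∧ Disjoint y.2 (A ∩ y.1)) _ ?_,
    card_filter_card_eq]
  intro A hA
  rw [← card_filter_add_card_filter_not (fun y : Finset (Fin n) × Finset (Fin n) =>
    #(y.1 ∩ A) = 0), filter_filter, filter_filter]
  have key : ∀ i ≤ 1, #{y : Finset (Fin n) × Finset (Fin n) | (#y.1 = 3 ∧ #(y.1 ∩ A) = i) ∧
      #y.2 = 3 ∧ #(y.2 ∩ A) ≤ 1 ∧ #(y.2 ∩ y.1) ≤ 1 ∧ Disjoint y.2 (A ∩ y.1)} =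
      (Nat.choose 3 i * (n - 3).choose (3 - i)) * ((n - (6 - i)).choose 3 +
        2 * (3 - i) * (n - (6 - i)).choose 2 + (3 - i) * (3 - i) * (n - (6 - i))) := by
    intro i hi
    rw [card_filter_prod_of_const (fun B => #B = 3 ∧ #(B ∩ A) = i)
      (fun B C => #C = 3 ∧ #(C ∩ A) ≤ 1 ∧ #(C ∩ B) ≤ 1 ∧ Disjoint C (A ∩ B)) _
      fun B hB => card_third_triple hA hB.1 hB.2, card_filter_card_inter A 3 i (by omega), hA,
      Fintype.card_fin]
  have k0 := key 0 (by simp)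
  have k1 := key 1 le_rfl
  simp only [Nat.choose_zero_right, one_mul, Nat.choose_one_right, Nat.sub_zero,
    Nat.add_one_sub_one, Nat.reduceMul] at k0 k1
  rw [← k0, ← k1]
  congr 2
  · ext y
    simp only [mem_filter, mem_univ, true_and]
    constructor
    · rintro ⟨⟨⟨h1, -⟩, h2⟩, h3⟩
      exact ⟨⟨h1, h3⟩, h2⟩
    · rintro ⟨⟨h1, h3⟩, h2⟩
      exact ⟨⟨⟨h1, by omega⟩, h2⟩, h3⟩
  · ext y
    simp only [mem_filter, mem_univ, true_and]
    constructor
    · rintro ⟨⟨⟨h1, h1'⟩, h2⟩, h3⟩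
      exact ⟨⟨h1, by omega⟩, h2⟩
    · rintro ⟨⟨h1, h3⟩, h2⟩
      exact ⟨⟨⟨h1, by omega⟩, h2⟩, by omega⟩

end Counting

section Values

variable {n : ℕ} {F : Coll n → ℤ}

/-- `F` satisfies the recursion of the Möbius function of `L(n,3)` from the minimum. -/
structure IsMobius (F : Coll n → ℤ) : Prop where
  empty : F ∅ = 1
  sum_le_eq_zero : ∀ B, memL n 3 B → B ≠ ∅ →
    ∑ T with memL n 3 T, (if collLE T B then F T else 0) = 0

lemma IsMobius.apply_triples (hF : IsMobius F) (T : Coll n) (hT : memL n 3 T)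
    (h3 : ∀ X ∈ T, #X = 3) : F T = (-1) ^ #T := by
  induction T using Finset.strongInduction with
  | H T ih =>
    rcases T.eq_empty_or_nonempty with rfl | hne
    · simp [hF.empty]
    · have h1 : ∑ S ∈ T.powerset, F S = 0 := by
        rw [← hF.sum_le_eq_zero T hT hne.ne_empty, ← sum_filter, filter_filter]
        congr 1
        ext S
        simp only [mem_powerset, mem_filter, mem_univ, true_and]
        constructor
        · intro h
          have hS := hT.subset h
          exact ⟨hS, (collLE_iff_subset hS h3).2 h⟩
        · rintro ⟨hS, h⟩
          exact (collLE_iff_subset hS h3).1 h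
      have h2 := sum_powerset_neg_one_pow_card_of_nonempty hne
      have h4 : ∑ S ∈ T.powerset.erase T, F S = ∑ S ∈ T.powerset.erase T, (-1 : ℤ) ^ #S := by
        refine sum_congr rfl fun S hS => ?_
        rw [mem_erase, mem_powerset] at hS
        exact ih S (hS.2.ssubset_of_ne hS.1) (hT.subset hS.2) fun X hX => h3 X (hS.2 hX)
      rw [← sum_erase_add _ _ (mem_powerset_self T)] at h1 h2
      linarith

lemma IsMobius.apply_triple (hF : IsMobius F) {A : Finset (Fin n)} (hA : #A = 3) :
    F {A} = -1 := by
  rw [hF.apply_triples {A} (memL_singleton.2 hA.le) (by simpa using hA)]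
  simp

lemma IsMobius.apply_triplePairs (hF : IsMobius F) {T : Coll n} (hT : T ∈ triplePairs n) :
    F T = 1 := by
  simp only [triplePairs, mem_filter, mem_univ, true_and] at hT
  rw [hF.apply_triples T hT.2.1 hT.2.2, hT.1]
  norm_num

lemma IsMobius.apply_tripleTriples (hF : IsMobius F) {T : Coll n} (hT : T ∈ tripleTriples n) :
    F T = -1 := by
  have h3 := mem_tripleTriples_card hT
  simp only [tripleTriples, mem_filter, mem_univ, true_and] at hT
  rw [hF.apply_triples T hT.2 h3, hT.1]
  norm_num

lemma sum_card_le_three (g : Finset (Fin n) → ℤ) :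
    ∑ X with #X ≤ 3, g X =
      ∑ X with #X = 0, g X + ∑ X with #X = 1, g X + ∑ X with #X = 2, g X +
        ∑ X with #X = 3, g X := by
  have h : ∑ X with #X ≤ 3, g X = ∑ k ∈ range 4,
      ∑ X ∈ ({X : Finset (Fin n) | #X ≤ 3} : Finset (Finset (Fin n))) with #X = k, g X := by
    refine (sum_fiberwise_of_maps_to (fun X hX => ?_) _).symm
    simpa using Nat.lt_succ_of_le (mem_filter.1 hX).2
  have hk : ∀ k ≤ 3,
      ∑ X ∈ ({X : Finset (Fin n) | #X ≤ 3} : Finset (Finset (Fin n))) with #X = k, g X =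
        ∑ X with #X = k, g X := by
    intro k hk
    congr 1
    ext X
    simp only [mem_filter, mem_univ, true_and]
    omega
  rw [h]
  simp only [sum_range_succ, range_zero, sum_empty, zero_add]
  rw [hk 0 (by simp), hk 1 (by simp), hk 2 (by simp), hk 3 le_rfl]

lemma IsMobius.sum_superset (hF : IsMobius F) {X : Finset (Fin n)} (hX : #X ≤ 3) :
    1 + (∑ Z with #Z = 0 ∧ X ⊆ Z, F {Z} + ∑ Z with #Z = 1 ∧ X ⊆ Z, F {Z} +
        ∑ Z with #Z = 2 ∧ X ⊆ Z, F {Z} - (#{Z : Finset (Fin n) | #Z = 3 ∧ X ⊆ Z} : ℤ)) +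
      (#{T ∈ triplePairs n | ∀ Z ∈ T, X ⊆ Z} : ℤ) +
      ∑ x ∈ mixedPairs n with X ⊆ x.1 ∧ X ⊆ x.2, F {x.1, x.2} -
      (#{T ∈ tripleTriples n | ∀ Z ∈ T, X ⊆ Z} : ℤ) = 0 := by
  have h := hF.sum_le_eq_zero {X} (memL_singleton.2 hX) (singleton_ne_empty X)
  have h1 : ∑ T with memL n 3 T, (if collLE T {X} then F T else 0) =
      ∑ T with memL n 3 T, (if ∀ Z ∈ T, X ⊆ Z then F T else 0) := by
    refine sum_congr rfl fun T hT => ?_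
    simp only [collLE_singleton_iff (mem_filter.1 hT).2 hX]
  have e3 : ∑ Z with #Z = 3 ∧ X ⊆ Z, F {Z} =
      -(#{Z : Finset (Fin n) | #Z = 3 ∧ X ⊆ Z} : ℤ) := by
    rw [sum_congr rfl fun Z hZ => hF.apply_triple (mem_filter.1 hZ).2.1]
    simp
  have e2 : ∑ T ∈ triplePairs n with (∀ Z ∈ T, X ⊆ Z), F T =
      (#{T ∈ triplePairs n | ∀ Z ∈ T, X ⊆ Z} : ℤ) := by
    rw [sum_congr rfl fun T hT => hF.apply_triplePairs (mem_filter.1 hT).1]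
    simp
  have e4 : ∑ T ∈ tripleTriples n with (∀ Z ∈ T, X ⊆ Z), F T =
      -(#{T ∈ tripleTriples n | ∀ Z ∈ T, X ⊆ Z} : ℤ) := by
    rw [sum_congr rfl fun T hT => hF.apply_tripleTriples (mem_filter.1 hT).1]
    simp
  rw [h1, sum_memL, sum_card_le_three] at h
  simp only [← sum_filter, filter_filter, mem_singleton, forall_eq, mem_insert,
    forall_eq_or_imp, notMem_empty, IsEmpty.forall_iff, implies_true, if_true, hF.empty] at h
  rw [e2, e3, e4] at h
  linarith

lemma filter_card_superset_eq_empty {X : Finset (Fin n)} {k : ℕ} (h : k < #X) :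
    ({Z | #Z = k ∧ X ⊆ Z} : Finset (Finset (Fin n))) = ∅ := by
  ext Z
  simp only [mem_filter, mem_univ, true_and, notMem_empty, iff_false, not_and]
  intro hZ hXZ
  have := card_le_card hXZ
  omega

lemma filter_card_superset_self (X : Finset (Fin n)) :
    ({Z | #Z = #X ∧ X ⊆ Z} : Finset (Finset (Fin n))) = {X} := by
  ext Z
  simp only [mem_filter, mem_univ, true_and, mem_singleton]
  constructor
  · rintro ⟨hZ, hXZ⟩
    exact (eq_of_subset_of_card_le hXZ hZ.le).symm
  · rintro rfl
    exact ⟨rfl, Subset.rfl⟩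

lemma filter_mixedPairs_eq_empty {X : Finset (Fin n)} (h : X.Nonempty) :
    ({x ∈ mixedPairs n | X ⊆ x.1 ∧ X ⊆ x.2} : Finset (Finset (Fin n) × Finset (Fin n))) = ∅ := by
  ext ⟨A, Y⟩
  simp only [mixedPairs, mem_filter, mem_univ, true_and, notMem_empty, iff_false]
  rintro ⟨⟨-, -, hd⟩, hA, hY⟩
  obtain ⟨x, hx⟩ := h
  exact Finset.disjoint_left.1 hd (hA hx) (hY hx)

lemma filter_tripleTriples_eq_empty {X : Finset (Fin n)} (h : X.Nonempty) :
    ({T ∈ tripleTriples n | ∀ Z ∈ T, X ⊆ Z} : Finset (Coll n)) = ∅ := by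
  ext T
  simp only [tripleTriples, mem_filter, mem_univ, true_and, notMem_empty, iff_false]
  rintro ⟨⟨hT, hm⟩, hX⟩
  obtain ⟨A, B, C, hAB, hAC, hBC, rfl⟩ := card_eq_three.1 hT
  have h0 := ((memL_triple hAB hAC hBC).1 hm).2.2.2.2
  obtain ⟨x, hx⟩ := h
  rw [card_eq_zero] at h0
  have : x ∈ A ∩ (B ∩ C) := by
    simp only [mem_inter]
    exact ⟨hX A (by simp) hx, hX B (by simp) hx, hX C (by simp) hx⟩
  rw [h0] at this
  exact notMem_empty x this

lemma filter_triplePairs_eq_empty {X : Finset (Fin n)} (h : 1 < #X) :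
    ({T ∈ triplePairs n | ∀ Z ∈ T, X ⊆ Z} : Finset (Coll n)) = ∅ := by
  ext T
  simp only [triplePairs, mem_filter, mem_univ, true_and, notMem_empty, iff_false]
  rintro ⟨⟨hT, hm, h3⟩, hX⟩
  obtain ⟨A, B, hAB, rfl⟩ := card_eq_two.1 hT
  have h1 := ((memL_pair hAB).1 hm).2.2
  have hA := h3 A (by simp)
  have hB := h3 B (by simp)
  have := card_le_card (subset_inter (hX A (by simp)) (hX B (by simp)))
  omega

lemma IsMobius.apply_two (hF : IsMobius F) (hn : 4 ≤ n) {Y : Finset (Fin n)} (hY : #Y = 2) :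
    F {Y} = n - 3 := by
  have h := hF.sum_superset (X := Y) (by omega)
  have hs := filter_card_superset_self Y
  rw [hY] at hs
  rw [filter_card_superset_eq_empty (by omega), filter_card_superset_eq_empty (by omega), hs,
    filter_mixedPairs_eq_empty (card_pos.1 (by omega)),
    filter_tripleTriples_eq_empty (card_pos.1 (by omega)),
    filter_triplePairs_eq_empty (by omega), card_filter_superset _ _ (by omega)] at h
  simp [hY] at h
  omega

lemma IsMobius.apply_one (hF : IsMobius F) (hn : 4 ≤ n) (x : Fin n) :
    2 * F {{x}} = -2 * (1 - ((n - 1).choose 2 : ℤ) + (n - 1) * (n - 3)) -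
      ((n - 1).choose 2 * (n - 3).choose 2 : ℤ) := by
  have h := hF.sum_superset (X := {x}) (by simp)
  have hs := filter_card_superset_self ({x} : Finset (Fin n))
  have hp := card_triplePairs_mem x
  rw [card_singleton] at hs
  have h2 : ∑ Z with #Z = 2 ∧ {x} ⊆ Z, F {Z} = (n - 1 : ℕ) * (n - 3) := by
    rw [sum_congr rfl fun Z hZ => hF.apply_two hn (mem_filter.1 hZ).2.1, sum_const,
      card_filter_superset _ _ (by simp)]
    simp
  rw [filter_card_superset_eq_empty (by simp), hs,
    filter_mixedPairs_eq_empty (singleton_nonempty x),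
    filter_tripleTriples_eq_empty (singleton_nonempty x),
    card_filter_superset _ _ (by simp),
    h2] at h
  simp only [sum_empty, sum_singleton, card_singleton, Nat.add_one_sub_one,
    card_empty] at h
  zify [show 1 ≤ n by omega] at h hp
  linarith

lemma rho_pair {A B : Finset (Fin n)} (h : A ≠ B) :
    rho 3 {A, B} = 8 - #A - #B := by
  simp only [rho, codim, sum_pair h]
  push_cast
  ring

lemma IsMobius.apply_mixed (hF : IsMobius F) (hn : 4 ≤ n) {A Y : Finset (Fin n)}
    (hA : #A = 3) (hY : #Y = 2) (hd : Disjoint A Y) : F {A, Y} = -(n - 3) := by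
  have hAY : A ≠ Y := by
    rintro rfl
    omega
  have hYA : ¬ Y ⊆ A := fun h => by
    rw [disjoint_comm, disjoint_iff_inter_eq_empty, inter_eq_left.2 h] at hd
    simp [hd] at hY
  have hr : rho 3 {A, Y} = 3 := by
    rw [rho_pair hAY, hA, hY]
    norm_num
  have h := hF.sum_le_eq_zero {A, Y} (memL_mixed hA hY hd) (by simp)
  have c0 : collLE ∅ {A, Y} := by
    refine Or.inr ⟨?_, by simp⟩
    rw [hr]
    simp [rho]
  have c1 : ∀ X : Finset (Fin n), #X ≤ 3 → (collLE {X} {A, Y} ↔ X = A ∨ Y ⊆ X) := by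
    intro X hX
    have hr' : rho 3 {X} = 4 - #X := by
      simp only [rho, codim, sum_singleton]
      norm_num
    constructor
    · rintro (he | ⟨-, h⟩)
      · have hc := card_pair hAY
        rw [← he] at hc
        simp at hc
      · simp only [mem_singleton, forall_eq, mem_insert, exists_eq_or_imp, exists_eq_left] at h
        exact h.imp_left fun h => (eq_of_subset_of_card_le h (hX.trans_eq hA.symm)).symm
    · intro h
      refine Or.inr ⟨?_, ?_⟩
      · have : 2 ≤ #X := by
          rcases h with rfl | h
          · omega
          · exact hY ▸ card_le_card h
        rw [hr, hr']
        omega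
      · simpa using h.imp_left fun h => h ▸ Subset.rfl
  have d0 : ∑ X with #X = 0, (if collLE {X} {A, Y} then F {X} else 0) = 0 := by
    refine sum_eq_zero fun X hX => if_neg ?_
    have hX := (mem_filter.1 hX).2
    rw [c1 X (by omega)]
    rintro (rfl | h)
    · omega
    · have := card_le_card h
      omega
  have d1 : ∑ X with #X = 1, (if collLE {X} {A, Y} then F {X} else 0) = 0 := by
    refine sum_eq_zero fun X hX => if_neg ?_
    have hX := (mem_filter.1 hX).2
    rw [c1 X (by omega)]
    rintro (rfl | h)
    · omega
    · have := card_le_card h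
      omega
  have d2 : ∑ X with #X = 2, (if collLE {X} {A, Y} then F {X} else 0) = n - 3 := by
    rw [← hF.apply_two hn hY, ← sum_filter, filter_filter]
    rw [← sum_singleton (fun X : Finset (Fin n) => F {X}) Y]
    congr 1
    ext X
    simp only [mem_filter, mem_univ, true_and, mem_singleton]
    constructor
    · rintro ⟨hX, h⟩
      rcases (c1 X (by omega)).1 h with rfl | h
      · omega
      · exact (eq_of_subset_of_card_le h (by omega)).symm
    · rintro rfl
      exact ⟨hY, (c1 X (by omega)).2 (Or.inr Subset.rfl)⟩
  have hcard : #{C : Finset (Fin n) | #C = 3 ∧ Y ⊆ C} = n - 2 := by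
    rw [card_filter_superset _ _ (by omega), hY]
    simp
  have d3 : ∑ X with #X = 3, (if collLE {X} {A, Y} then F {X} else 0) = -(n - 1) := by
    have he : ({X | #X = 3 ∧ collLE {X} {A, Y}} : Finset (Finset (Fin n))) =
        insert A ({C | #C = 3 ∧ Y ⊆ C} : Finset (Finset (Fin n))) := by
      ext X
      simp only [mem_filter, mem_univ, true_and, mem_insert]
      constructor
      · rintro ⟨hX, h⟩
        rw [c1 X hX.le] at h
        tauto
      · rintro (rfl | ⟨hX, h⟩)
        · exact ⟨hA, (c1 X hA.le).2 (Or.inl rfl)⟩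
        · exact ⟨hX, (c1 X hX.le).2 (Or.inr h)⟩
    rw [← sum_filter, filter_filter,
      sum_congr rfl fun X hX => hF.apply_triple (mem_filter.1 hX).2.1, sum_const, he,
      card_insert_of_notMem (by simp [hYA]), hcard]
    simp
    omega
  have d4 : ∑ T ∈ triplePairs n, (if collLE T {A, Y} then F T else 0) = n - 2 := by
    have he : ({T ∈ triplePairs n | collLE T {A, Y}} : Finset (Coll n)) =
        ({C | #C = 3 ∧ Y ⊆ C} : Finset (Finset (Fin n))).image fun C => {A, C} := by
      ext T
      simp only [triplePairs, mem_filter, mem_univ, true_and, mem_image]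
      constructor
      · rintro ⟨⟨hT, hm, h3⟩, h⟩
        obtain ⟨B, C, hBC, rfl⟩ := card_eq_two.1 hT
        have hB := h3 B (by simp)
        have hC := h3 C (by simp)
        have hi := ((memL_pair hBC).1 hm).2.2
        have h' : ∀ X ∈ ({B, C} : Coll n), X = A ∨ Y ⊆ X := by
          intro X hX
          rcases h with he | ⟨-, h⟩
          · have := h3 Y (he ▸ by simp)
            omega
          · obtain ⟨Z, hZ, hZX⟩ := h X hX
            simp only [mem_insert, mem_singleton] at hZ
            rcases hZ with rfl | rfl
            · exact Or.inl (eq_of_subset_of_card_le hZX (by rw [h3 X hX, hA])).symm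
            · exact Or.inr hZX
        rcases h' B (by simp) with rfl | hB'
        · rcases h' C (by simp) with rfl | hC'
          · exact absurd rfl hBC
          · exact ⟨C, ⟨hC, hC'⟩, rfl⟩
        · rcases h' C (by simp) with rfl | hC'
          · exact ⟨B, ⟨hB, hB'⟩, pair_comm _ _⟩
          · have := card_le_card (subset_inter hB' hC')
            omega
      · rintro ⟨C, ⟨hC, hYC⟩, rfl⟩
        have hAC : A ≠ C := by
          rintro rfl
          exact hYA hYC
        have hi : #(A ∩ C) ≤ 1 := by
          have h1 : #(A ∩ C) + #Y ≤ #C := by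
            rw [← card_union_of_disjoint (hd.mono_left inter_subset_left)]
            exact card_le_card (union_subset inter_subset_right hYC)
          omega
        refine ⟨⟨card_pair hAC, (memL_pair hAC).2 ⟨by omega, by omega, by omega⟩,
          by simp [hA, hC]⟩, Or.inr ⟨?_, ?_⟩⟩
        · rw [hr, rho_pair hAC, hA, hC]
          norm_num
        · simp [hYC]
    rw [← sum_filter, sum_congr rfl fun T hT => hF.apply_triplePairs (mem_filter.1 hT).1,
      sum_const, he, card_image_of_injOn, hcard]
    · simp
      omega
    · intro C hC C' hC' h
      simp only [coe_filter, mem_univ, true_and, Set.mem_ofPred_eq] at hC hC' h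
      have h1 : C ∈ ({A, C'} : Coll n) := h ▸ by simp
      simp only [mem_insert, mem_singleton] at h1
      rcases h1 with rfl | h1
      · exact absurd hC.2 hYA
      · exact h1
  have d5 : ∑ x ∈ mixedPairs n, (if collLE {x.1, x.2} {A, Y} then F {x.1, x.2} else 0) =
      F {A, Y} := by
    have hmem : (A, Y) ∈ mixedPairs n := by simp [mixedPairs, hA, hY, hd]
    rw [sum_eq_single_of_mem (A, Y) hmem]
    · exact if_pos (Or.inl rfl)
    rintro ⟨B, Z⟩ hx hne
    refine if_neg ?_
    simp only [mixedPairs, mem_filter, mem_univ, true_and] at hx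
    obtain ⟨hB, hZ, -⟩ := hx
    rintro (he | ⟨hlt, -⟩)
    · have h1 : B ∈ ({A, Y} : Coll n) := he ▸ by simp
      have h2 : Z ∈ ({A, Y} : Coll n) := he ▸ by simp
      simp only [mem_insert, mem_singleton] at h1 h2
      rcases h1 with rfl | rfl <;> rcases h2 with rfl | rfl <;> first | exact hne rfl | omega
    · have hBZ : B ≠ Z := by
        rintro rfl
        omega
      rw [hr, rho_pair hBZ, hB, hZ] at hlt
      norm_num at hlt
  have d6 : ∑ T ∈ tripleTriples n, (if collLE T {A, Y} then F T else 0) = 0 := by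
    refine sum_eq_zero fun T hT => if_neg ?_
    simp only [tripleTriples, mem_filter, mem_univ, true_and] at hT
    rintro (rfl | ⟨hlt, -⟩)
    · rw [card_pair hAY] at hT
      omega
    · have := hT.2.card_le_rho
      omega
  rw [sum_memL, sum_card_le_three, d0, d1, d2, d3, d4, d5, d6, if_pos c0, hF.empty] at h
  linarith

lemma IsMobius.apply_top_eq (hF : IsMobius F) (hn : 4 ≤ n) :
    1 + F {∅} + ∑ x, F {{x}} + n.choose 2 * (n - 3) - n.choose 3 + #(triplePairs n) -
      #(mixedPairs n) * (n - 3) - #(tripleTriples n) = 0 := by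
  have h := hF.sum_superset (X := ∅) (by simp)
  have h1 : ∑ Z with #Z = 1, F {Z} = ∑ x, F {{x}} := by
    refine (sum_bij (fun x _ => {x}) ?_ ?_ ?_ ?_).symm
    · simp
    · simp
    · intro Z hZ
      obtain ⟨x, rfl⟩ := card_eq_one.1 (mem_filter.1 hZ).2
      exact ⟨x, mem_univ x, rfl⟩
    · simp
  have h2 : ∑ Z with #Z = 2, F {Z} = n.choose 2 * (n - 3) := by
    rw [sum_congr rfl fun Z hZ => hF.apply_two hn (mem_filter.1 hZ).2, sum_const,
      card_filter_card_eq]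
    simp
  have h3 : ∑ x ∈ mixedPairs n, F {x.1, x.2} = -(#(mixedPairs n) * (n - 3)) := by
    rw [sum_congr rfl fun x hx => ?_, sum_const, nsmul_eq_mul, mul_neg]
    simp only [mixedPairs, mem_filter, mem_univ, true_and] at hx
    rw [hF.apply_mixed hn hx.1 hx.2.1 hx.2.2]
  have h0 : ∑ Z : Finset (Fin n) with #Z = 0, F {Z} = F {∅} := by
    simp [card_eq_zero, filter_eq']
  simp only [empty_subset, and_true, and_self, implies_true, filter_true, h0, h1, h2, h3,
    card_filter_card_eq] at h
  linarith

lemma IsMobius.apply_top (hF : IsMobius F) (hn : 4 ≤ n) :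
    F {∅} = -1 + (n : ℤ) - (Nat.choose n 2 : ℤ) + (Nat.choose n 3 : ℤ)
        + 20 * (Nat.choose n 5 : ℤ) + 170 * (Nat.choose n 6 : ℤ)
        + 630 * (Nat.choose n 7 : ℤ) + 840 * (Nat.choose n 8 : ℤ)
        + 280 * (Nat.choose n 9 : ℤ) := by
  have h := hF.apply_top_eq hn
  have h1 : 2 * ∑ x, F {{x}} = n * (-2 * (1 - ((n - 1).choose 2 : ℤ) + (n - 1) * (n - 3)) -
      ((n - 1).choose 2 * (n - 3).choose 2 : ℤ)) := by
    rw [mul_sum, sum_congr rfl fun x _ => hF.apply_one hn x, sum_const]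
    simp
  have hp := card_triplePairs (n := n)
  have hm := card_mixedPairs (n := n)
  have ht := card_tripleTriples (n := n)
  have hmul : ∀ s j, n.choose s * (n - s).choose j = n.choose (s + j) * (s + j).choose s := by
    intro s j
    rw [Nat.choose_mul (Nat.le_add_right s j), Nat.add_sub_cancel_left]
  have a1 := hmul 1 2
  have a2 := hmul 3 2
  have a3 := hmul 3 3
  have b1 := hmul 5 1
  have b2 := hmul 5 2
  have b3 := hmul 5 3
  have c1 := hmul 6 1
  have c2 := hmul 6 2
  have c3 := hmul 6 3
  have e1 := hmul 2 1
  have e0 := hmul 1 1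
  simp only [Nat.choose_one_right, show Nat.choose (1 + 2) 1 = 3 from rfl,
    show Nat.choose (3 + 2) 3 = 10 from rfl, show Nat.choose (3 + 3) 3 = 20 from rfl,
    show Nat.choose (5 + 1) 5 = 6 from rfl, show Nat.choose (5 + 2) 5 = 21 from rfl,
    show Nat.choose (5 + 3) 5 = 56 from rfl, show Nat.choose (6 + 1) 6 = 7 from rfl,
    show Nat.choose (6 + 2) 6 = 28 from rfl, show Nat.choose (6 + 3) 6 = 84 from rfl,
    show Nat.choose (2 + 1) 2 = 3 from rfl, show Nat.choose (1 + 1) 1 = 2 from rfl,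
    Nat.reduceAdd] at a1 a2 a3 b1 b2 b3 c1 c2 c3 e0 e1
  have ht' : 6 * #(tripleTriples n) =
      1680 * n.choose 9 + 5040 * n.choose 8 + 3780 * n.choose 7 + 720 * n.choose 6 := by
    linear_combination ht +
      ((n - 6).choose 3 + 6 * (n - 6).choose 2 + 9 * (n - 6)) * a3 +
      3 * ((n - 5).choose 3 + 4 * (n - 5).choose 2 + 4 * (n - 5)) * a2 +
      20 * c3 + 120 * c2 + 180 * c1 + 30 * b3 + 120 * b2 + 120 * b1
  have hp' : 2 * #(triplePairs n) = 20 * n.choose 6 + 30 * n.choose 5 := by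
    linear_combination hp + a3 + 3 * a2
  have b1' : (n.choose 5 : ℤ) * (n - 5) = 6 * n.choose 6 := by
    rcases Nat.lt_or_ge n 5 with h5 | h5
    · simp [Nat.choose_eq_zero_of_lt h5, Nat.choose_eq_zero_of_lt (h5.trans (by simp : 5 < 6))]
    · zify [h5] at b1
      linarith
  zify [show 1 ≤ n by omega, show 2 ≤ n by omega] at a1 a2 e0 e1 hp' ht' hm
  have s1 : 2 * ∑ x, F {{x}} =
      -2 * n - 6 * n.choose 3 + 4 * n.choose 2 - 30 * n.choose 5 := by
    linear_combination h1 + (2 - ((n - 3).choose 2 : ℤ)) * a1 - 2 * (n - 3) * e0 - 3 * a2 -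
      4 * e1
  have s2 : (n.choose 2 : ℤ) * (n - 3) = 3 * n.choose 3 - n.choose 2 := by
    linear_combination e1
  have s3 : (#(mixedPairs n) : ℤ) * (n - 3) = 60 * n.choose 6 + 20 * n.choose 5 := by
    linear_combination (n - 3) * hm + (n - 3) * a2 + 10 * b1'
  linarith

end Values

lemma L.le_iff_collLE {n : ℕ} {S T : L n 3} : S ≤ T ↔ collLE S.val T.val := by
  refine or_congr_left ⟨fun h => h ▸ rfl, fun h => ?_⟩
  cases S
  cases T
  simpa using h

lemma Lbot_le {n : ℕ} (T : L n 3) : Lbot n 3 ≤ T := by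
  rw [L.le_iff_collLE]
  rcases T.val.eq_empty_or_nonempty with h | h
  · exact Or.inl h.symm
  · refine Or.inr ⟨?_, by simp [Lbot]⟩
    have h1 := T.mem.card_le_rho
    have h2 := card_pos.2 h
    have h3 : rho 3 (Lbot n 3).val = 0 := sum_empty
    omega

/-- For `n ≥ 4`,
`μ_{n,3}(⊤) = −1 + n − C(n,2) + C(n,3) + 20·C(n,5) + 170·C(n,6) + 630·C(n,7)
+ 840·C(n,8) + 280·C(n,9)`, where `⊤ = {∅}` is the maximum element of `L(n,3)`
and `μ_{n,3}` is the Möbius function of `L(n,3)` evaluated from the minimum `∅`. -/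
theorem mobius_top_dim_three (n : ℕ) (hn : 4 ≤ n)
    (μ : L n 3 → L n 3 → ℤ)
    (hrefl : ∀ A : L n 3, μ A A = 1)
    (hrec : ∀ A B : L n 3, A < B →
      ∑ S ∈ Finset.univ.filter (fun S : L n 3 => A ≤ S ∧ S ≤ B), μ A S = 0) :
    μ (Lbot n 3) (Ltop n 3) =
      -1 + (n : ℤ) - (Nat.choose n 2 : ℤ) + (Nat.choose n 3 : ℤ)
        + 20 * (Nat.choose n 5 : ℤ) + 170 * (Nat.choose n 6 : ℤ)
        + 630 * (Nat.choose n 7 : ℤ) + 840 * (Nat.choose n 8 : ℤ)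
        + 280 * (Nat.choose n 9 : ℤ) := by
  let F : Coll n → ℤ := fun T => if h : memL n 3 T then μ (Lbot n 3) ⟨T, h⟩ else 0
  have hval : ∀ T : L n 3, F T.val = μ (Lbot n 3) T := fun T => dif_pos T.mem
  have hF : IsMobius F := by
    refine ⟨(hval (Lbot n 3)).trans (hrefl _), fun B hB hne => ?_⟩
    have hlt : Lbot n 3 < ⟨B, hB⟩ :=
      (Lbot_le _).lt_of_ne fun h => hne (congrArg L.val h).symm
    have h := hrec _ _ hlt
    rw [sum_filter] at h
    refine Eq.trans (Eq.symm ?_) h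
    refine sum_bij (fun (T : L n 3) _ => T.val) ?_ ?_ ?_ ?_
    · intro T _
      simp [T.mem]
    · rintro ⟨S, hS⟩ - ⟨T, hT⟩ - rfl
      rfl
    · intro T hT
      exact ⟨⟨T, (mem_filter.1 hT).2⟩, mem_univ _, rfl⟩
    · intro T _
      rw [hval]
      exact if_congr ((and_iff_right (Lbot_le T)).trans L.le_iff_collLE) rfl rfl
  rw [← hval]
  exact hF.apply_top hn
end
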